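/- Let V be a finite-dimensional real vector space and let G be a subgroup of the group Aff(V) of affine equivalences of V. Assume H := lin(G) acts irreducibly on V, and assume that the translation set T(G) := {v ∈ V : τ_v ∈ G} is (the carrier of) a linear subspace of V. Then exactly one of the following holds: either T(G) = {0}, equivalently the restriction of the linear-part homomorphism lin to G is injective (so G is isomorphic to H); or T(G) = V and G equals the full preimage {g ∈ Aff(V) : lin(g) ∈ H}, i.e. G contains every translation and G is isomorphic to the semidirect product H ⋉ V. (Proposition 4.2: for an irreducible Riemannian manifold, the affine holonomy group is isomorphic either to the Levi-Civita holonomy group Hol(g)_x or to the semidirect product Hol(g)_x ⋉ T_xM.) -/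

import Mathlib

/-- The set of translation vectors of translations belonging to a subgroup `G` of the
group of affine equivalences of `V`. -/
def translationSet (V : Type*) [AddCommGroup V] [Module ℝ V]
    (G : Subgroup (V ≃ᵃ[ℝ] V)) : Set V :=
  {v : V | AffineEquiv.constVAdd ℝ V v ∈ G}

namespace AffineEquiv

variable {k V : Type*} [Ring k] [AddCommGroup V] [Module k V]

theorem map_eq_linearHom_add (g : V ≃ᵃ[k] V) (x : V) : g x = linearHom g x + g 0 := by
  simpa using g.map_vadd 0 x

/-- An affine equivalence with trivial linear part is a translation. -/
theorem eq_constVAdd_of_linearHom_eq_one {g : V ≃ᵃ[k] V} (hg : linearHom g = 1) :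
    g = constVAdd k V (g 0) := by
  ext x
  rw [map_eq_linearHom_add, hg]
  simp [add_comm]

/-- Conjugating the translation by `v` with `g` gives the translation by the image of `v` under
the linear part of `g`. -/
theorem mul_constVAdd_mul_inv (g : V ≃ᵃ[k] V) (v : V) :
    g * constVAdd k V v * g⁻¹ = constVAdd k V (linearHom g v) := by
  ext x
  have h : g (g⁻¹ x) = x := g.apply_symm_apply x
  simp only [mul_def, trans_apply, constVAdd_apply, map_vadd, h]
  rfl

end AffineEquiv

/-- Proposition 4.2: if `H := lin(G)` acts irreducibly on `V` and the translation set
`T(G)` is a linear subspace, then exactly one of the following holds: either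
`T(G) = {0}` and the linear-part homomorphism restricted to `G` is injective, or
`T(G) = V` and `G` is the full preimage of `H` under the linear-part homomorphism. -/
theorem translationSet_trivial_or_full
    (V : Type*) [AddCommGroup V] [Module ℝ V] [FiniteDimensional ℝ V] [Nontrivial V]
    (G : Subgroup (V ≃ᵃ[ℝ] V))
    (hirr : ∀ W : Submodule ℝ V,
      (∀ σ ∈ Subgroup.map (AffineEquiv.linearHom) G, ∀ w ∈ W, σ w ∈ W) →
      W = ⊥ ∨ W = ⊤)
    (hsub : ∃ W : Submodule ℝ V, (W : Set V) = translationSet V G) :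
    Xor'
      (translationSet V G = {(0 : V)} ∧
        Function.Injective (fun g : G => AffineEquiv.linearHom (g : V ≃ᵃ[ℝ] V)))
      (translationSet V G = Set.univ ∧
        G = Subgroup.comap (AffineEquiv.linearHom)
              (Subgroup.map (AffineEquiv.linearHom) G)) := by
  obtain ⟨W, hW⟩ := hsub
  have mem_translationSet (v : V) :
      v ∈ translationSet V G ↔ AffineEquiv.constVAdd ℝ V v ∈ G := Iff.rfl
  have translation_mem {g : V ≃ᵃ[ℝ] V} (hg : g ∈ G) (h1 : AffineEquiv.linearHom g = 1) :
      g 0 ∈ translationSet V G := by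
    rwa [mem_translationSet, ← AffineEquiv.eq_constVAdd_of_linearHom_eq_one h1]
  have invariant : ∀ σ ∈ Subgroup.map (AffineEquiv.linearHom) G, ∀ w ∈ W, σ w ∈ W := by
    rintro _ ⟨g, hg, rfl⟩ w hw
    rw [← SetLike.mem_coe, hW, mem_translationSet] at hw ⊢
    rw [← AffineEquiv.mul_constVAdd_mul_inv]
    exact G.mul_mem (G.mul_mem hg hw) (G.inv_mem hg)
  have exclusive : ({0} : Set V) ≠ Set.univ := Set.singleton_ne_univ 0
  rcases hirr W invariant with rfl | rfl
  · have hT : translationSet V G = {0} := by rw [← hW, Submodule.bot_coe]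
    refine Or.inl ⟨⟨hT, ?_⟩, fun h => exclusive (hT.symm.trans h.1)⟩
    rintro ⟨g, hg⟩ ⟨h, hh⟩ hgh
    have h1 : AffineEquiv.linearHom (g * h⁻¹) = 1 := by
      rw [map_mul, map_inv, mul_inv_eq_one]
      exact hgh
    have h0 := translation_mem (G.mul_mem hg (G.inv_mem hh)) h1
    rw [hT, Set.mem_singleton_iff] at h0
    have hone := AffineEquiv.eq_constVAdd_of_linearHom_eq_one h1
    rw [h0, AffineEquiv.constVAdd_zero] at hone
    exact Subtype.ext (mul_inv_eq_one.mp hone)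
  · have hT : translationSet V G = Set.univ := by rw [← hW, Submodule.top_coe]
    refine Or.inr ⟨⟨hT, le_antisymm (Subgroup.le_comap_map _ _) ?_⟩,
      fun h => exclusive (h.1.symm.trans hT)⟩
    rintro g ⟨h, hh, hgh⟩
    have h1 : AffineEquiv.linearHom (g * h⁻¹) = 1 := by
      rw [map_mul, map_inv, hgh, mul_inv_cancel]
    have hmem : g * h⁻¹ ∈ G := by
      rw [AffineEquiv.eq_constVAdd_of_linearHom_eq_one h1, ← mem_translationSet, hT]
      trivial
    simpa using G.mul_mem hmem hh
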